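/- For every positive integer N and every index k=(k_1,…,k_r), the connected sums satisfy the boundary conditions Z_{N,t}(k_↑;∅) = G_N(k;t) and Z_{N,t}((1);k) = F_N(k;t) in ℚ(t), where k_↑ = (k_1,…,k_{r−1},k_r+1) and (1) is the index of depth 1 with single entry 1. -/

import Mathlib

open scoped Classical

/-- The rising factorial `(a)_n = a(a+1)⋯(a+n-1)` in `ℚ(t)`. -/
noncomputable def rfac (a : RatFunc ℚ) (n : ℕ) : RatFunc ℚ :=
  ∏ j ∈ Finset.range n, (a + ((j : ℕ) : RatFunc ℚ))

/-- The connector `C_{N,t}(n,m)` (both arguments unflipped):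
`C_{N,t}(n,m) = (-1)^{n-1}·n·binom(m,n)·(1-N-t)_{n+m}/((1-N-t)_n·(1-N-t)_m)`. -/
noncomputable def Cnn (N n m : ℕ) : RatFunc ℚ :=
  (-1 : RatFunc ℚ) ^ (n - 1) * (n : RatFunc ℚ) * ((Nat.choose m n : ℕ) : RatFunc ℚ) *
    rfac (1 - (N : RatFunc ℚ) - RatFunc.X) (n + m) /
    (rfac (1 - (N : RatFunc ℚ) - RatFunc.X) n *
      rfac (1 - (N : RatFunc ℚ) - RatFunc.X) m)

/-- The connector `C_{N,t}(N-n+t, m)` (first argument flipped). -/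
noncomputable def Cfn (N n m : ℕ) : RatFunc ℚ :=
  (((N : RatFunc ℚ) - (n : RatFunc ℚ) + RatFunc.X) /
      ((N : RatFunc ℚ) - (n : RatFunc ℚ) - (m : RatFunc ℚ) + RatFunc.X)) * Cnn N n m

/-- The connector `C_{N,t}(n, N-m+t)` (second argument flipped):
`C_{N,t}(n, N-m+t) = C_{N,t}(n, m-1)` (in particular `C_{N,t}(n, N-1+t) = 0`). -/
noncomputable def Cnf (N n m : ℕ) : RatFunc ℚ := Cnn N n (m - 1)

/-- The connector `C_{N,t}(N-n+t, N-m+t)` (both arguments flipped). -/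
noncomputable def Cff (N n m : ℕ) : RatFunc ℚ :=
  (((N : RatFunc ℚ) - (n : RatFunc ℚ) + RatFunc.X) *
      ((N : RatFunc ℚ) - (m : RatFunc ℚ) + RatFunc.X) /
      ((m : RatFunc ℚ) *
        ((N : RatFunc ℚ) - (n : RatFunc ℚ) - (m : RatFunc ℚ) + RatFunc.X))) * Cnn N n m

/-- The connected sum `Z_{N,t}(k;l) ∈ ℚ(t)` of two (nonempty) indices `k`, `l`:
the sum over `A ⊂ [r]¹_k`, `B ⊂ [s]`, `(n₁,…,n_r) ∈ S⋆_{r,N}(A)` and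
`(m₁,…,m_s) ∈ S̄_{s,N}(B)` of `(-1)^{#B}` times the connector `C_{N,t}(x,y)` (with
`x = N-n_r+t` if `r ∈ A`, `x = n_r` otherwise; `y = N-m₁+t` if `1 ∈ B`, `y = m₁`
otherwise) times `(∏_{i∈A} 1/(N-nᵢ+t))·(∏_{i∉A} 1/nᵢ^{kᵢ})·(∏_{j∈B} 1/(N-mⱼ+t)^{lⱼ})·(∏_{j∉B} 1/mⱼ^{lⱼ})`. -/
noncomputable def Zcon (N : ℕ) (k l : List ℕ) : RatFunc ℚ :=
  ∑ A : Finset (Fin k.length), ∑ B : Finset (Fin l.length),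
    if ∀ i ∈ A, k.get i = 1 then
      ∑ n ∈ Finset.univ.filter (fun n : Fin k.length → Fin N =>
          (∀ i, 0 < (n i : ℕ)) ∧
          ∀ (i : Fin k.length) (h : (i : ℕ) + 1 < k.length),
            if i ∉ A ∧ (⟨(i : ℕ) + 1, h⟩ : Fin k.length) ∈ A then
              n i < n ⟨(i : ℕ) + 1, h⟩
            else n i ≤ n ⟨(i : ℕ) + 1, h⟩),
        ∑ m ∈ Finset.univ.filter (fun m : Fin l.length → Fin N =>
            (∀ j, 0 < (m j : ℕ)) ∧
            ∀ (j : Fin l.length) (h : (j : ℕ) + 1 < l.length),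
              if (⟨(j : ℕ) + 1, h⟩ : Fin l.length) ∈ B then m j < m ⟨(j : ℕ) + 1, h⟩
              else m j ≤ m ⟨(j : ℕ) + 1, h⟩),
          (-1 : RatFunc ℚ) ^ B.card *
          (if hk : 0 < k.length then
            if hl : 0 < l.length then
              (if (⟨k.length - 1, Nat.sub_lt hk Nat.one_pos⟩ : Fin k.length) ∈ A then
                (if (⟨0, hl⟩ : Fin l.length) ∈ B then
                  Cff N (n ⟨k.length - 1, Nat.sub_lt hk Nat.one_pos⟩ : ℕ) (m ⟨0, hl⟩ : ℕ)
                else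
                  Cfn N (n ⟨k.length - 1, Nat.sub_lt hk Nat.one_pos⟩ : ℕ) (m ⟨0, hl⟩ : ℕ))
              else
                (if (⟨0, hl⟩ : Fin l.length) ∈ B then
                  Cnf N (n ⟨k.length - 1, Nat.sub_lt hk Nat.one_pos⟩ : ℕ) (m ⟨0, hl⟩ : ℕ)
                else
                  Cnn N (n ⟨k.length - 1, Nat.sub_lt hk Nat.one_pos⟩ : ℕ) (m ⟨0, hl⟩ : ℕ)))
            else 0
          else 0) *
          (∏ i : Fin k.length,
            if i ∈ A then 1 / ((N : RatFunc ℚ) - ((n i : ℕ) : RatFunc ℚ) + RatFunc.X)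
            else 1 / (((n i : ℕ) : RatFunc ℚ)) ^ k.get i) *
          (∏ j : Fin l.length,
            if j ∈ B then
              1 / ((N : RatFunc ℚ) - ((m j : ℕ) : RatFunc ℚ) + RatFunc.X) ^ l.get j
            else 1 / (((m j : ℕ) : RatFunc ℚ)) ^ l.get j)
    else 0

/-- The connected sum `Z_{N,t}(k_↑; ∅) ∈ ℚ(t)`, defined directly from `k`:
the sum over `A ⊂ [r]¹_k ∖ {r}` and `(n₁,…,n_r) ∈ S⋆_{r,N}(A)` of
`C_{N,t}(n_r, N-1)·(∏_{i∈A} 1/(N-nᵢ+t))·(∏_{i∉A} 1/nᵢ^{kᵢ})·(1/n_r)`. -/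
noncomputable def ZconUp (N : ℕ) (k : List ℕ) : RatFunc ℚ :=
  ∑ A : Finset (Fin k.length),
    if ∀ i ∈ A, k.get i = 1 ∧ (i : ℕ) + 1 ≠ k.length then
      ∑ n ∈ Finset.univ.filter (fun n : Fin k.length → Fin N =>
          (∀ i, 0 < (n i : ℕ)) ∧
          ∀ (i : Fin k.length) (h : (i : ℕ) + 1 < k.length),
            if i ∉ A ∧ (⟨(i : ℕ) + 1, h⟩ : Fin k.length) ∈ A then
              n i < n ⟨(i : ℕ) + 1, h⟩
            else n i ≤ n ⟨(i : ℕ) + 1, h⟩),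
        (if hk : 0 < k.length then
          Cnn N (n ⟨k.length - 1, Nat.sub_lt hk Nat.one_pos⟩ : ℕ) (N - 1) *
            (1 / (((n ⟨k.length - 1, Nat.sub_lt hk Nat.one_pos⟩ : ℕ) : ℕ) : RatFunc ℚ))
        else 0) *
        ∏ i : Fin k.length,
          if i ∈ A then 1 / ((N : RatFunc ℚ) - ((n i : ℕ) : RatFunc ℚ) + RatFunc.X)
          else 1 / (((n i : ℕ) : RatFunc ℚ)) ^ k.get i
    else 0

/-- The Kawashima-like function `F_N(k;t) ∈ ℚ(t)`. -/
noncomputable def FNL (N : ℕ) (k : List ℕ) : RatFunc ℚ :=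
  ∑ A : Finset (Fin k.length),
    (-1 : RatFunc ℚ) ^ A.card *
    ∑ n ∈ Finset.univ.filter (fun n : Fin k.length → Fin N =>
      (∀ i, 0 < (n i : ℕ)) ∧
      ∀ (i : Fin k.length) (h : (i : ℕ) + 1 < k.length),
        if (⟨(i : ℕ) + 1, h⟩ : Fin k.length) ∈ A then n i < n ⟨(i : ℕ) + 1, h⟩
        else n i ≤ n ⟨(i : ℕ) + 1, h⟩),
      ∏ i : Fin k.length,
        if i ∈ A then
          1 / ((N : RatFunc ℚ) - ((n i : ℕ) : RatFunc ℚ) + RatFunc.X) ^ k.get i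
        else 1 / (((n i : ℕ) : RatFunc ℚ)) ^ k.get i

/-- The factor `(-1)^{n_r-1} · binom(t, n_r) · (1-N)_{n_r} / (1-N-t)_{n_r}`
appearing in `G_N`, with `t = RatFunc.X`. -/
noncomputable def lastFactor (N nr : ℕ) : RatFunc ℚ :=
  (-1 : RatFunc ℚ) ^ (nr - 1) *
    ((∏ j ∈ Finset.range nr, (RatFunc.X - ((j : ℕ) : RatFunc ℚ))) /
      ((Nat.factorial nr : ℕ) : RatFunc ℚ)) *
    rfac (1 - (N : RatFunc ℚ)) nr / rfac (1 - (N : RatFunc ℚ) - RatFunc.X) nr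

/-- The function `G_N(k;t) ∈ ℚ(t)`. -/
noncomputable def GNL (N : ℕ) (k : List ℕ) : RatFunc ℚ :=
  ∑ A : Finset (Fin k.length),
    if ∀ i ∈ A, k.get i = 1 ∧ (i : ℕ) + 1 ≠ k.length then
      ∑ n ∈ Finset.univ.filter (fun n : Fin k.length → Fin N =>
        (∀ i, 0 < (n i : ℕ)) ∧
        ∀ (i : Fin k.length) (h : (i : ℕ) + 1 < k.length),
          if i ∉ A ∧ (⟨(i : ℕ) + 1, h⟩ : Fin k.length) ∈ A then
            n i < n ⟨(i : ℕ) + 1, h⟩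
          else n i ≤ n ⟨(i : ℕ) + 1, h⟩),
        (∏ i : Fin k.length,
          if i ∈ A then 1 / ((N : RatFunc ℚ) - ((n i : ℕ) : RatFunc ℚ) + RatFunc.X)
          else 1 / (((n i : ℕ) : RatFunc ℚ)) ^ k.get i) *
        (∏ i : Fin k.length,
          if (i : ℕ) + 1 = k.length then lastFactor N (n i : ℕ) else 1)
    else 0

lemma rfac_succ (a : RatFunc ℚ) (n : ℕ) : rfac a (n+1) = rfac a n * (a + (n : RatFunc ℚ)) := by
  simp [rfac, Finset.prod_range_succ]

lemma rfac_add (a : RatFunc ℚ) (p q : ℕ) :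
    rfac a (p + q) = rfac a p * rfac (a + (p : RatFunc ℚ)) q := by
  simp [rfac, Finset.prod_range_add, add_assoc]

lemma rfac_succ' (a : RatFunc ℚ) (n : ℕ) : rfac a (n+1) = a * rfac (a + 1) n := by
  rw [add_comm, rfac_add]; simp [rfac]

lemma X_ne_const (c : ℚ) : (RatFunc.X : RatFunc ℚ) ≠ RatFunc.C c := by
  rw [← RatFunc.algebraMap_X, ← RatFunc.algebraMap_C]
  intro h
  exact Polynomial.X_ne_C c (RatFunc.algebraMap_injective ℚ h)

lemma lin_ne (N : ℕ) (j : ℕ) : (1 - (N : RatFunc ℚ) - RatFunc.X) + (j : RatFunc ℚ) ≠ 0 := by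
  intro h
  apply X_ne_const (1 - (N : ℚ) + (j : ℚ))
  simp only [map_add, map_sub, map_one, map_natCast]
  linear_combination -h

lemma rfac_ne (N n : ℕ) : rfac (1 - (N : RatFunc ℚ) - RatFunc.X) n ≠ 0 := by
  unfold rfac
  exact Finset.prod_ne_zero_iff.mpr fun j _ => lin_ne N j

lemma partial_sum (a : RatFunc ℚ) (ha : ∀ n, rfac a n ≠ 0) (p M : ℕ) :
    ∑ j ∈ Finset.range (M+1), (-1 : RatFunc ℚ) ^ j * ((Nat.choose (p+1) j : ℕ) : RatFunc ℚ) *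
      rfac (a + (p : RatFunc ℚ)) j / rfac a j =
    (-1) ^ M * ((Nat.choose p M : ℕ) : RatFunc ℚ) * rfac (a + p + 1) M / rfac a M := by
  induction M with
  | zero => simp [rfac]
  | succ M ih =>
    rw [Finset.sum_range_succ, ih]
    have h1 := ha M
    have h2 := ha (M+1)
    rw [rfac_succ' (a + p) M, rfac_succ (a + p + 1) M]
    rw [rfac_succ] at h2 ⊢
    have h3 : a + (M : RatFunc ℚ) ≠ 0 := fun h => h2 (by simp [h])
    have hc : ((Nat.choose p (M+1) : ℕ) : RatFunc ℚ) * (M + 1) + (M : RatFunc ℚ) * (Nat.choose p M : ℕ)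
        = (Nat.choose p M : ℕ) * (p : RatFunc ℚ) := by
      rcases le_or_gt M p with h | h
      · have := Nat.choose_succ_right_eq p M
        obtain ⟨d, rfl⟩ := Nat.exists_eq_add_of_le h
        rw [Nat.add_sub_cancel_left] at this
        have h' : (((M+d).choose (M+1) * (M+1) : ℕ) : RatFunc ℚ) = (((M+d).choose M * d : ℕ) : RatFunc ℚ) := by
          rw [this]
        push_cast at h' ⊢
        linear_combination h'
      · simp [Nat.choose_eq_zero_of_lt h, Nat.choose_eq_zero_of_lt (show p < M + 1 by omega)]
    rw [Nat.choose_succ_succ']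
    generalize rfac (a + p + 1) M = R at *
    generalize rfac a M = S at *
    push_cast
    rw [pow_succ]
    rw [div_add_div _ _ h1 h2, div_eq_div_iff (mul_ne_zero h1 h2) h2]
    linear_combination ((-1)^M * R * S * S * (a + M)) * hc

lemma full_sum (a : RatFunc ℚ) (ha : ∀ n, rfac a n ≠ 0) (p M : ℕ) (h : p < M) :
    ∑ j ∈ Finset.range M, (-1 : RatFunc ℚ) ^ j * ((Nat.choose (p+1) (j+1) : ℕ) : RatFunc ℚ) *
      rfac (a + (p : RatFunc ℚ)) (j+1) / rfac a (j+1) = 1 := by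
  have := partial_sum a ha p M
  rw [Finset.sum_range_succ', Nat.choose_eq_zero_of_lt h] at this
  simp only [Nat.choose_zero_right, rfac, Finset.range_zero, Finset.prod_empty] at this
  simp only [rfac]
  simp only [pow_succ, mul_neg_one, neg_mul, neg_div, Finset.sum_neg_distrib] at this
  simp at this
  linear_combination -this

lemma rfac_big (a : RatFunc ℚ) (j p : ℕ) : rfac a (j + 1 + (p + 1)) =
    rfac a p * rfac (a + (p : RatFunc ℚ)) (j+1) * (a + p + (j + 1 : ℕ)) := by
  rw [show j + 1 + (p+1) = p + (j+1+1) by ring, rfac_add, rfac_succ _ (j+1)]; ring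

lemma term_n (N j p : ℕ) :
    Cnn N (j+1) (p+1) * (1 / ((j+1 : ℕ) : RatFunc ℚ)) +
      Cfn N (j+1) (p+1) * (1 / ((N : RatFunc ℚ) - ((j+1 : ℕ) : RatFunc ℚ) + RatFunc.X)) =
    (-1 : RatFunc ℚ) ^ j * ((Nat.choose (p+1) (j+1) : ℕ) : RatFunc ℚ) *
      rfac (1 - (N : RatFunc ℚ) - RatFunc.X + (p : RatFunc ℚ)) (j+1) /
        rfac (1 - (N : RatFunc ℚ) - RatFunc.X) (j+1) := by
  have hN : (N : RatFunc ℚ) = 1 - (1 - (N : RatFunc ℚ) - RatFunc.X) - RatFunc.X := by ring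
  unfold Cfn Cnn
  have h1 := rfac_ne N (j+1)
  have h2 := rfac_ne N p
  have h3 := lin_ne N p
  have h4 := lin_ne N j
  have h5 := lin_ne N (p + (j+1))
  have h0 : ((j : RatFunc ℚ) + 1) ≠ 0 := by exact_mod_cast Nat.succ_ne_zero j
  rw [rfac_big, rfac_succ _ p]
  generalize 1 - (N : RatFunc ℚ) - RatFunc.X = a at *
  rw [hN]
  push_cast at *
  have e1 : 1 - a - RatFunc.X - ((j : RatFunc ℚ) + 1) + RatFunc.X = -(a + (j : RatFunc ℚ)) := by ring
  have e2 : 1 - a - RatFunc.X - ((j : RatFunc ℚ) + 1) - ((p : RatFunc ℚ) + 1) + RatFunc.X = -(a + ((p : RatFunc ℚ) + ((j : RatFunc ℚ) + 1))) := by ring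
  rw [e1, e2, ← add_assoc a]
  rw [← add_assoc a] at h5
  generalize rfac (a + (p : RatFunc ℚ)) (j+1) = R at *
  generalize rfac a (j+1) = S at *
  generalize rfac a p = T at *
  field_simp
  ring

lemma term_f (N j p : ℕ) :
    Cnf N (j+1) (p+1) * (1 / ((j+1 : ℕ) : RatFunc ℚ)) +
      Cff N (j+1) (p+1) * (1 / ((N : RatFunc ℚ) - ((j+1 : ℕ) : RatFunc ℚ) + RatFunc.X)) =
    (-1 : RatFunc ℚ) ^ j * ((Nat.choose (p+1) (j+1) : ℕ) : RatFunc ℚ) *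
      rfac (1 - (N : RatFunc ℚ) - RatFunc.X + (p : RatFunc ℚ)) (j+1) /
        rfac (1 - (N : RatFunc ℚ) - RatFunc.X) (j+1) := by
  have hN : (N : RatFunc ℚ) = 1 - (1 - (N : RatFunc ℚ) - RatFunc.X) - RatFunc.X := by ring
  unfold Cff Cnf Cnn
  have h1 := rfac_ne N (j+1)
  have h2 := rfac_ne N p
  have h3 := lin_ne N p
  have h4 := lin_ne N j
  have h5 := lin_ne N (p + (j+1))
  have h0 : ((j : RatFunc ℚ) + 1) ≠ 0 := by exact_mod_cast Nat.succ_ne_zero j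
  have h0' : ((p : RatFunc ℚ) + 1) ≠ 0 := by exact_mod_cast Nat.succ_ne_zero p
  have hc : ((p : RatFunc ℚ) + 1) * (Nat.choose p j : ℕ) = (Nat.choose (p+1) (j+1) : ℕ) * ((j : RatFunc ℚ) + 1) := by
    exact_mod_cast Nat.add_one_mul_choose_eq p j
  have hc2 : ((Nat.choose (p+1) (j+1) : ℕ) : RatFunc ℚ) = (Nat.choose p j : ℕ) + (Nat.choose p (j+1) : ℕ) := by
    exact_mod_cast Nat.choose_succ_succ' p j
  rw [Nat.add_sub_cancel, Nat.add_sub_cancel, rfac_big, rfac_succ _ p, add_comm (j+1) p, rfac_add]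
  generalize 1 - (N : RatFunc ℚ) - RatFunc.X = a at *
  rw [hN]
  push_cast at *
  have e1 : 1 - a - RatFunc.X - ((j : RatFunc ℚ) + 1) + RatFunc.X = -(a + (j : RatFunc ℚ)) := by ring
  have e3 : 1 - a - RatFunc.X - ((p : RatFunc ℚ) + 1) + RatFunc.X = -(a + (p : RatFunc ℚ)) := by ring
  have e2 : 1 - a - RatFunc.X - ((j : RatFunc ℚ) + 1) - ((p : RatFunc ℚ) + 1) + RatFunc.X = -(a + ((p : RatFunc ℚ) + ((j : RatFunc ℚ) + 1))) := by ring
  rw [e1, e2, e3, ← add_assoc a]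
  rw [← add_assoc a] at h5
  generalize rfac (a + (p : RatFunc ℚ)) (j+1) = R at *
  generalize rfac a (j+1) = S at *
  generalize rfac a p = T at *
  have hB : ((Nat.choose (p+1) (j+1) : ℕ) : RatFunc ℚ) * ((j : RatFunc ℚ) + 1) / ((p : RatFunc ℚ) + 1) = (Nat.choose p j : ℕ) := by
    rw [← hc]; field_simp
  generalize hcc : ((Nat.choose (p+1) (j+1) : ℕ) : RatFunc ℚ) = c at *
  have : (-1) ^ j * ((j : RatFunc ℚ) + 1) * (Nat.choose p (j+1) : ℕ) * (T * R) / (S * T) * (1 / ((j : RatFunc ℚ) + 1)) +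
      -(a + (j : RatFunc ℚ)) * -(a + (p : RatFunc ℚ)) / (((p : RatFunc ℚ) + 1) * -(a + (p : RatFunc ℚ) + ((j : RatFunc ℚ) + 1))) *
        ((-1) ^ j * ((j : RatFunc ℚ) + 1) * c * (T * R * (a + (p : RatFunc ℚ) + ((j : RatFunc ℚ) + 1))) / (S * (T * (a + (p : RatFunc ℚ))))) *
        (1 / -(a + (j : RatFunc ℚ))) = (-1)^j * R / S * ((Nat.choose p (j+1) : ℕ) + c * ((j : RatFunc ℚ) + 1) / ((p : RatFunc ℚ) + 1)) := by
    field_simp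
  rw [this, hB, hc2]
  ring

lemma key_n (N m : ℕ) (h0 : 0 < m) (h : m < N) :
    ∑ j ∈ Finset.range (N-1), Cnn N (j+1) m * (1 / ((j+1 : ℕ) : RatFunc ℚ)) +
    ∑ j ∈ Finset.range (N-1), Cfn N (j+1) m * (1 / ((N : RatFunc ℚ) - ((j+1 : ℕ) : RatFunc ℚ) + RatFunc.X)) = 1 := by
  obtain ⟨p, rfl⟩ := Nat.exists_eq_add_of_le' h0
  rw [← Finset.sum_add_distrib, Finset.sum_congr rfl fun j _ => term_n N j p]
  exact full_sum _ (rfac_ne N) p (N-1) (by omega)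

lemma key_f (N m : ℕ) (h0 : 0 < m) (h : m < N) :
    ∑ j ∈ Finset.range (N-1), Cnf N (j+1) m * (1 / ((j+1 : ℕ) : RatFunc ℚ)) +
    ∑ j ∈ Finset.range (N-1), Cff N (j+1) m * (1 / ((N : RatFunc ℚ) - ((j+1 : ℕ) : RatFunc ℚ) + RatFunc.X)) = 1 := by
  obtain ⟨p, rfl⟩ := Nat.exists_eq_add_of_le' h0
  rw [← Finset.sum_add_distrib, Finset.sum_congr rfl fun j _ => term_f N j p]
  exact full_sum _ (rfac_ne N) p (N-1) (by omega)

lemma last_eq (N n : ℕ) (h0 : 0 < n) (h : n < N) :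
    Cnn N n (N-1) * (1 / (n : RatFunc ℚ)) = lastFactor N n := by
  unfold Cnn lastFactor
  have hn : (n : RatFunc ℚ) ≠ 0 := by exact_mod_cast h0.ne'
  have hf : ((n.factorial : ℕ) : RatFunc ℚ) ≠ 0 := by exact_mod_cast n.factorial_ne_zero
  have h1 := rfac_ne N n
  have h2 := rfac_ne N (N-1)
  have e0 : (1 - (N : RatFunc ℚ) - RatFunc.X) + ((N - 1 : ℕ) : RatFunc ℚ) = -RatFunc.X := by
    rw [Nat.cast_sub (by omega)]; push_cast; ring
  rw [add_comm n, rfac_add, e0]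
  have e1 : ∀ n, rfac (-RatFunc.X) n = (-1)^n * ∏ j ∈ Finset.range n, (RatFunc.X - ((j : ℕ) : RatFunc ℚ)) := by
    intro n
    induction n with
    | zero => simp [rfac]
    | succ n ih => rw [rfac_succ, ih, Finset.prod_range_succ]; ring
  have e2 : ∀ n, rfac (1 - (N : RatFunc ℚ)) n = (-1)^n * ((Nat.descFactorial (N-1) n : ℕ) : RatFunc ℚ) := by
    intro n
    induction n with
    | zero => simp [rfac]
    | succ n ih =>
      rw [rfac_succ, ih, Nat.descFactorial_succ]
      rcases le_or_gt n (N-1) with hh | hh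
      · rw [Nat.cast_mul, Nat.cast_sub hh, Nat.cast_sub (by omega)]; push_cast; ring
      · rw [Nat.descFactorial_eq_zero_iff_lt.mpr hh]; simp
  rw [e1, e2, Nat.descFactorial_eq_factorial_mul_choose]
  push_cast
  field_simp

lemma sum_one (N : ℕ) (f : ℕ → RatFunc ℚ) (P : (Fin 1 → Fin N) → Prop)
    [DecidablePred P] (hP : ∀ n, P n ↔ 0 < (n 0 : ℕ))
    (g : (Fin 1 → Fin N) → RatFunc ℚ) (hg : ∀ n, g n = f (n 0 : ℕ)) :
    ∑ n ∈ Finset.univ.filter P, g n = ∑ j ∈ Finset.range (N-1), f (j+1) := by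
  refine Finset.sum_bij (fun n _ => (n 0 : ℕ) - 1) ?_ ?_ ?_ ?_
  · intro n hn
    have := (hP n).1 (Finset.mem_filter.1 hn).2
    have := (n 0).2
    simp only [Finset.mem_range]; omega
  · intro n hn n' hn' h
    have h1 := (hP n).1 (Finset.mem_filter.1 hn).2
    have h2 := (hP n').1 (Finset.mem_filter.1 hn').2
    funext i
    rw [Subsingleton.elim i 0]
    apply Fin.ext
    omega
  · intro j hj
    rw [Finset.mem_range] at hj
    refine ⟨fun _ => ⟨j+1, by omega⟩, ?_, ?_⟩
    · simp [hP]
    · simp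
  · intro n hn
    have h1 := (hP n).1 (Finset.mem_filter.1 hn).2
    rw [hg]; congr 1; omega

lemma fin1_sets (f : Finset (Fin 1) → RatFunc ℚ) : ∑ A, f A = f ∅ + f {0} := by
  have : (Finset.univ : Finset (Finset (Fin 1))) = {∅, {0}} := by decide
  rw [this, Finset.sum_pair (by decide)]

theorem boundary_conditions (N : ℕ) (hNpos : 0 < N) (k : List ℕ)
    (hk : k ≠ []) (hkpos : ∀ x ∈ k, 0 < x) :
    ZconUp N k = GNL N k ∧ Zcon N [1] k = FNL N k := by
  have hl : 0 < k.length := List.length_pos_iff.mpr hk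
  constructor
  · unfold ZconUp GNL
    refine Finset.sum_congr rfl fun A _ => ?_
    split_ifs with hA
    · refine Finset.sum_congr rfl fun n hn => ?_
      have hn' := (Finset.mem_filter.1 hn).2.1
      rw [last_eq N _ (hn' _) (n _).2, mul_comm]
      congr 1
      rw [Finset.prod_eq_single (⟨k.length - 1, Nat.sub_lt hl Nat.one_pos⟩ : Fin k.length)]
      · rw [if_pos (by simp; omega)]
      · intro b _ hb
        rw [if_neg]
        intro h
        apply hb
        apply Fin.ext
        simp; omega
      · simp
    · rfl
  · unfold Zcon FNL
    rw [Finset.sum_comm]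
    refine Finset.sum_congr rfl fun B _ => ?_
    rw [Finset.mul_sum]
    refine (fin1_sets _).trans ?_
    rw [if_pos (by simp), if_pos (by intro i _; fin_cases i; rfl)]
    rw [Finset.sum_comm]
    conv_lhs => rw [add_comm, Finset.sum_comm, add_comm]
    rw [← Finset.sum_add_distrib]
    refine Finset.sum_congr rfl fun m hm => ?_
    have hm' := (Finset.mem_filter.1 hm).2.1 ⟨0, hl⟩
    have hm2 := (m ⟨0, hl⟩).2
    simp only [hl, dif_pos]
    generalize (∏ j : Fin k.length,
            if j ∈ B then
              1 / ((N : RatFunc ℚ) - ((m j : ℕ) : RatFunc ℚ) + RatFunc.X) ^ k.get j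
            else 1 / (((m j : ℕ) : RatFunc ℚ)) ^ k.get j) = Q
    have hsub : Subsingleton (Fin [1].length) := inferInstanceAs (Subsingleton (Fin 1))
    have hP : ∀ (A : Finset (Fin 1)) (n : Fin 1 → Fin N),
        ((∀ i, 0 < (n i : ℕ)) ∧
          ∀ (i : Fin 1) (h : (i : ℕ) + 1 < 1),
            if i ∉ A ∧ (⟨(i : ℕ) + 1, h⟩ : Fin 1) ∈ A then
              n i < n ⟨(i : ℕ) + 1, h⟩
            else n i ≤ n ⟨(i : ℕ) + 1, h⟩) ↔ 0 < (n 0 : ℕ) := by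
      intro A n
      constructor
      · intro h; exact h.1 0
      · intro h
        refine ⟨fun i => by rw [Subsingleton.elim i 0]; exact h, fun i hi => by omega⟩
    let f1 : ℕ → RatFunc ℚ := (fun x => (-1 : RatFunc ℚ) ^ B.card *
      (if (⟨0, hl⟩ : Fin k.length) ∈ B then Cnf N x (m ⟨0, hl⟩ : ℕ) else Cnn N x (m ⟨0, hl⟩ : ℕ)) *
      (1 / (x : RatFunc ℚ)) * Q)
    let f2 : ℕ → RatFunc ℚ := (fun x => (-1 : RatFunc ℚ) ^ B.card *
      (if (⟨0, hl⟩ : Fin k.length) ∈ B then Cff N x (m ⟨0, hl⟩ : ℕ) else Cfn N x (m ⟨0, hl⟩ : ℕ)) *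
      (1 / ((N : RatFunc ℚ) - (x : RatFunc ℚ) + RatFunc.X)) * Q)
    have hmem : ∀ {x : Fin [1].length}, x ∈ ({0} : Finset (Fin 1)) := by
      intro x
      exact Finset.mem_singleton.mpr (Subsingleton.elim (α := Fin 1) x 0)
    refine (congrArg₂ (· + ·) (sum_one N f1 _ (hP ∅) _ fun n => ?_)
      (sum_one N f2 _ (hP {0}) _ fun n => ?_)).trans ?_
    · rw [Fintype.prod_subsingleton _ (⟨0, Nat.one_pos⟩ : Fin [1].length)]
      rw [dif_pos (show 0 < [1].length from Nat.one_pos), if_neg (Finset.notMem_empty _),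
        if_neg (Finset.notMem_empty _)]
      have : ([1] : List ℕ).get ⟨0, Nat.one_pos⟩ = 1 := rfl
      rw [this, pow_one]
      rfl
    · rw [Fintype.prod_subsingleton _ (⟨0, Nat.one_pos⟩ : Fin [1].length)]
      rw [dif_pos (show 0 < [1].length from Nat.one_pos), if_pos hmem, if_pos hmem]
      rfl
    · dsimp only [f1, f2]
      rw [← Finset.sum_mul, ← Finset.sum_mul, ← add_mul]
      simp only [mul_assoc]
      rw [← Finset.mul_sum, ← Finset.mul_sum, ← mul_add]
      congr 1
      have hS : ∀ c S : RatFunc ℚ, S = 1 → c * S = c := by rintro c _ rfl; ring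
      apply hS
      split_ifs
      · exact key_f N _ hm' hm2
      · exact key_n N _ hm' hm2
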